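/- arXiv:2311.01585 — 12 statements merged into one kernel-verified Lean document; each statement's English description precedes it below -/
import Mathlib

section
/- Let Ω ⊆ ℝⁿ be open, p > 2 a real number, and k > 0 a constant such that ∫_Ω v² dx ≤ k ∫_Ω ‖∇v‖² dx for every continuously differentiable v : Ω → ℝ with compact support in Ω. Then for every continuously differentiable u : Ω → ℝ with compact support in Ω one has ∫_Ω |u|^p dx ≤ ((p√k)/2)^p ∫_Ω ‖∇u‖^p dx. -/
open MeasureTheory

theorem norm_gradient {F : Type*} [NormedAddCommGroup F] [InnerProductSpace ℝ F]
    [CompleteSpace F] (f : F → ℝ) (x : F) : ‖gradient f x‖ = ‖fderiv ℝ f x‖ :=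
  (InnerProductSpace.toDual ℝ F).symm.norm_map _

/-- Absorbing a power of the left-hand side after an application of Hölder's inequality. -/
theorem Real.le_rpow_mul_of_le_mul_rpow {A B C θ : ℝ} (hA : 0 ≤ A) (hB : 0 ≤ B) (hC : 0 ≤ C)
    (hθ : 0 < θ) (h : A ≤ C * (A ^ (1 - θ) * B ^ θ)) : A ≤ C ^ θ⁻¹ * B := by
  rcases hA.eq_or_lt with rfl | hA'
  · positivity
  have hAθ : A ^ θ ≤ C * B ^ θ := by
    have hsplit : A ^ (1 - θ) * A ^ θ = A := by
      rw [← Real.rpow_add hA']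
      simp
    refine le_of_mul_le_mul_left ?_ (Real.rpow_pos_of_pos hA' (1 - θ))
    rw [hsplit]
    linarith
  calc A = (A ^ θ) ^ θ⁻¹ := (Real.rpow_rpow_inv hA hθ.ne').symm
    _ ≤ (C * B ^ θ) ^ θ⁻¹ := by gcongr
    _ = C ^ θ⁻¹ * B := by
      rw [Real.mul_rpow hC (by positivity), Real.rpow_rpow_inv hB hθ.ne']

/-- Hölder's inequality with exponents `p / (p - 2)` and `p / 2`, for powers of norms. -/
theorem integral_rpow_sub_two_mul_sq_le {X E F : Type*} [TopologicalSpace X] [MeasurableSpace X]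
    [OpensMeasurableSpace X] {μ : Measure X} [IsFiniteMeasureOnCompacts μ]
    [NormedAddCommGroup E] [NormedAddCommGroup F] {f : X → E} {g : X → F}
    (hf : Continuous f) (hf' : HasCompactSupport f) (hg : Continuous g)
    (hg' : HasCompactSupport g) {p : ℝ} (hp : 2 < p) (S : Set X) :
    ∫ x in S, ‖f x‖ ^ (p - 2) * ‖g x‖ ^ 2 ∂μ ≤
      (∫ x in S, ‖f x‖ ^ p ∂μ) ^ (1 - 2 / p) * (∫ x in S, ‖g x‖ ^ p ∂μ) ^ (2 / p) := by
  have hp0 : 0 < p := by linarith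
  have hp2 : 0 < p - 2 := by linarith
  have hpq : (p / (p - 2)).HolderConjugate (p / 2) := by
    rw [Real.holderConjugate_iff]
    refine ⟨by rw [lt_div_iff₀ hp2]; linarith, ?_⟩
    field_simp
    ring
  have hF : MemLp (fun x ↦ ‖f x‖ ^ (p - 2)) (ENNReal.ofReal (p / (p - 2))) (μ.restrict S) :=
    ((hf.norm.rpow_const fun _ ↦ .inr hp2.le).memLp_of_hasCompactSupport
      (hf'.comp_left (g := fun y ↦ ‖y‖ ^ (p - 2)) (by simp [hp2.ne']))).restrict S
  have hG : MemLp (fun x ↦ ‖g x‖ ^ 2) (ENNReal.ofReal (p / 2)) (μ.restrict S) :=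
    ((hg.norm.pow 2).memLp_of_hasCompactSupport
      (hg'.comp_left (g := fun y ↦ ‖y‖ ^ (2 : ℕ)) (by simp))).restrict S
  have hFpow (x : X) : (‖f x‖ ^ (p - 2)) ^ (p / (p - 2)) = ‖f x‖ ^ p := by
    rw [← Real.rpow_mul (norm_nonneg _), mul_div_cancel₀ _ hp2.ne']
  have hGpow (x : X) : (‖g x‖ ^ 2) ^ (p / 2) = ‖g x‖ ^ p := by
    rw [← Real.rpow_natCast_mul (norm_nonneg _)]
    congr 1
    push_cast
    ring
  have h := integral_mul_le_Lp_mul_Lq_of_nonneg hpq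
    (.of_forall fun x ↦ by positivity) (.of_forall fun x ↦ by positivity) hF hG
  simp only [hFpow, hGpow, one_div_div] at h
  rwa [sub_div, div_self hp0.ne'] at h

/-- The `L^p`-coercivity estimate from the proof of Theorem 3.5(b): if the Poincaré
inequality `∫_Ω v² ≤ k ∫_Ω ‖∇v‖²` holds for all `C¹` functions `v` with compact support
in the open set `Ω ⊆ ℝⁿ`, then for every such `u` and `p > 2`,
`∫_Ω |u|^p ≤ ((p√k)/2)^p ∫_Ω ‖∇u‖^p`. -/
theorem stmt3 {n : ℕ} (Ω : Set (EuclideanSpace ℝ (Fin n))) (hΩ : IsOpen Ω)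
    (p k : ℝ) (hp : 2 < p) (hk : 0 < k)
    (hpoinc : ∀ v : EuclideanSpace ℝ (Fin n) → ℝ, ContDiff ℝ 1 v → HasCompactSupport v →
      tsupport v ⊆ Ω →
      ∫ x in Ω, (v x) ^ 2 ≤ k * ∫ x in Ω, ‖gradient v x‖ ^ 2)
    (u : EuclideanSpace ℝ (Fin n) → ℝ) (hu : ContDiff ℝ 1 u)
    (husupp : HasCompactSupport u) (huΩ : tsupport u ⊆ Ω) :
    ∫ x in Ω, |u x| ^ p ≤ ((p * Real.sqrt k) / 2) ^ p * ∫ x in Ω, ‖gradient u x‖ ^ p := by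
  have hp0 : 0 < p := by linarith
  have hq : 1 < p / 2 := by linarith
  have hgrad : Continuous (gradient u) :=
    (InnerProductSpace.toDual ℝ _).symm.continuous.comp (hu.continuous_fderiv one_ne_zero)
  have hgrad_supp : HasCompactSupport (gradient u) :=
    (husupp.fderiv ℝ).comp_left (map_zero (InnerProductSpace.toDual ℝ _).symm)
  set v : EuclideanSpace ℝ (Fin n) → ℝ := fun x ↦ ‖u x‖ ^ (p / 2) with hv_def
  have hv0 : (fun y : ℝ ↦ ‖y‖ ^ (p / 2)) 0 = 0 := by
    simp [hp0.ne']
  have hv : ContDiff ℝ 1 v := hu.norm_rpow hq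
  have hv_supp : HasCompactSupport v := husupp.comp_left (g := fun y : ℝ ↦ ‖y‖ ^ (p / 2)) hv0
  have hvΩ : tsupport v ⊆ Ω :=
    (closure_mono (Function.support_comp_subset (g := fun y : ℝ ↦ ‖y‖ ^ (p / 2)) hv0 u)).trans huΩ
  have hv_sq (x) : v x ^ 2 = ‖u x‖ ^ p := by
    rw [hv_def, ← Real.rpow_mul_natCast (norm_nonneg _)]
    congr 1
    push_cast
    ring
  have hgrad_v (x) :
      ‖gradient v x‖ ^ 2 ≤ (p / 2) ^ 2 * (‖u x‖ ^ (p - 2) * ‖gradient u x‖ ^ 2) := by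
    have h : ‖gradient v x‖ ≤ p / 2 * ‖u x‖ ^ (p / 2 - 1) * ‖gradient u x‖ := by
      simpa only [norm_gradient] using
        norm_fderiv_norm_rpow_le (hu.differentiable one_ne_zero) hq
    calc ‖gradient v x‖ ^ 2 ≤ (p / 2 * ‖u x‖ ^ (p / 2 - 1) * ‖gradient u x‖) ^ 2 := by gcongr
      _ = (p / 2) ^ 2 * ((‖u x‖ ^ (p / 2 - 1)) ^ 2 * ‖gradient u x‖ ^ 2) := by ring
      _ = _ := by
        rw [← Real.rpow_mul_natCast (norm_nonneg _)]
        congr 4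
        push_cast
        ring
  have hint : Integrable (fun x ↦ (p / 2) ^ 2 * (‖u x‖ ^ (p - 2) * ‖gradient u x‖ ^ 2))
      (volume.restrict Ω) := by
    refine Integrable.restrict (Continuous.integrable_of_hasCompactSupport ?_ ?_)
    · exact continuous_const.mul ((hu.continuous.norm.rpow_const fun _ ↦ .inr (by linarith)).mul
        (hgrad.norm.pow 2))
    · exact ((hgrad_supp.comp_left (g := fun y ↦ ‖y‖ ^ (2 : ℕ)) (by simp)).mul_left).mul_left
  have hmain : ∫ x in Ω, ‖u x‖ ^ p ≤ k * (p / 2) ^ 2 *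
      ((∫ x in Ω, ‖u x‖ ^ p) ^ (1 - 2 / p) * (∫ x in Ω, ‖gradient u x‖ ^ p) ^ (2 / p)) := by
    calc ∫ x in Ω, ‖u x‖ ^ p = ∫ x in Ω, v x ^ 2 := by simp only [hv_sq]
      _ ≤ k * ∫ x in Ω, ‖gradient v x‖ ^ 2 := hpoinc v hv hv_supp hvΩ
      _ ≤ k * ∫ x in Ω, (p / 2) ^ 2 * (‖u x‖ ^ (p - 2) * ‖gradient u x‖ ^ 2) := by
        exact mul_le_mul_of_nonneg_left (integral_mono_of_nonneg
          (.of_forall fun x ↦ by positivity) hint (.of_forall hgrad_v)) hk.le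
      _ = k * (p / 2) ^ 2 * ∫ x in Ω, ‖u x‖ ^ (p - 2) * ‖gradient u x‖ ^ 2 := by
        rw [integral_const_mul, mul_assoc]
      _ ≤ _ := by
        gcongr
        exact integral_rpow_sub_two_mul_sq_le hu.continuous husupp hgrad hgrad_supp hp Ω
  have hconst : (k * (p / 2) ^ 2) ^ (2 / p)⁻¹ = (p * √k / 2) ^ p := by
    have hsq : k * (p / 2) ^ 2 = (p * √k / 2) ^ 2 := by
      rw [div_pow, div_pow, mul_pow, Real.sq_sqrt hk.le]
      ring
    rw [hsq, ← Real.rpow_natCast_mul (by positivity)]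
    congr 1
    push_cast
    field_simp
  rw [← hconst]
  exact Real.le_rpow_mul_of_le_mul_rpow (integral_nonneg fun x ↦ by positivity)
    (integral_nonneg fun x ↦ by positivity) (by positivity) (by positivity) hmain
end

section
/- Let (X, μ) be a measure space, H a real Hilbert space, p ≥ 2 a real number, and F, G : X → H strongly measurable with ∫_X ‖F‖^p dμ < ∞ and ∫_X ‖G‖^p dμ < ∞. Then the function t ↦ ∫_X ‖G + t(F−G)‖^{p−2} ⟨G + t(F−G), F−G⟩ dμ is continuous on the interval [0, 1]. -/
open scoped RealInnerProductSpace
open MeasureTheory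
open scoped ENNReal

/-- A `p`-Laplacian type pairing at a point of the segment from `v` to `u` is dominated by the
`p`-th powers of the norms of the endpoints. -/
lemma norm_rpow_mul_inner_segment_le {H : Type*} [NormedAddCommGroup H] [InnerProductSpace ℝ H]
    {p : ℝ} (hp : 2 ≤ p) (u v : H) {t : ℝ} (ht : t ∈ Set.Icc (0 : ℝ) 1) :
    ‖‖v + t • (u - v)‖ ^ (p - 2) * ⟪v + t • (u - v), u - v⟫‖ ≤ 2 * (‖u‖ ^ p + ‖v‖ ^ p) := by
  set m := max ‖u‖ ‖v‖ with hm
  have hm0 : 0 ≤ m := (norm_nonneg u).trans (le_max_left _ _)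
  have hw : ‖v + t • (u - v)‖ ≤ m :=
    (convexOn_univ_norm.le_max_of_mem_segment (Set.mem_univ u) (Set.mem_univ v)
      (segment_symm ℝ v u ▸ segment_eq_image' ℝ v u ▸ ⟨t, ht, rfl⟩))
  have hd : ‖u - v‖ ≤ 2 * m := by
    linarith [norm_sub_le u v, le_max_left ‖u‖ ‖v‖, le_max_right ‖u‖ ‖v‖]
  have hmp : m ^ p ≤ ‖u‖ ^ p + ‖v‖ ^ p := by
    have hu : 0 ≤ ‖u‖ ^ p := by positivity
    have hv : 0 ≤ ‖v‖ ^ p := by positivity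
    rcases max_choice ‖u‖ ‖v‖ with h | h <;> rw [hm, h] <;> linarith
  calc ‖‖v + t • (u - v)‖ ^ (p - 2) * ⟪v + t • (u - v), u - v⟫‖
      = ‖v + t • (u - v)‖ ^ (p - 2) * ‖⟪v + t • (u - v), u - v⟫‖ := by
        rw [norm_mul, Real.norm_of_nonneg (by positivity)]
    _ ≤ m ^ (p - 2) * (m * (2 * m)) := by
        gcongr
        exact (norm_inner_le_norm _ _).trans (by gcongr)
    _ = 2 * (m ^ (p - 2) * m ^ (2 : ℝ)) := by
        rw [Real.rpow_two]
        ring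
    _ = 2 * m ^ p := by
        rw [← Real.rpow_add_of_nonneg hm0 (by linarith) zero_le_two, sub_add_cancel]
    _ ≤ 2 * (‖u‖ ^ p + ‖v‖ ^ p) := by gcongr

/-- A strongly measurable function whose `p`-th power norm has finite lower integral has an
integrable `p`-th power norm. -/
lemma integrable_norm_rpow_of_lintegral_lt_top {X : Type*} [MeasurableSpace X] {μ : Measure X}
    {E : Type*} [NormedAddCommGroup E] {f : X → E} {p : ℝ} (hf : StronglyMeasurable f)
    (h : ∫⁻ x, ENNReal.ofReal (‖f x‖ ^ p) ∂μ < ∞) : Integrable (fun x => ‖f x‖ ^ p) μ :=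
  ⟨(hf.norm.measurable.pow_const p).aestronglyMeasurable,
    (hasFiniteIntegral_iff_ofReal (.of_forall fun _ => by positivity)).2 h⟩

/-- Hemi-continuity of `L_p` (Proposition 3.7) in gradient form: for strongly measurable
`F G : X → H` with `∫ ‖F‖^p < ∞` and `∫ ‖G‖^p < ∞` (`p ≥ 2`), the map
`t ↦ ∫ ‖G + t(F-G)‖^(p-2) ⟨G + t(F-G), F-G⟩ dμ` is continuous on `[0, 1]`. -/
theorem stmt4 {X : Type*} [MeasurableSpace X] (μ : Measure X)
    {H : Type*} [NormedAddCommGroup H] [InnerProductSpace ℝ H] [CompleteSpace H]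
    (p : ℝ) (hp : 2 ≤ p) (F G : X → H)
    (hFmeas : StronglyMeasurable F) (hGmeas : StronglyMeasurable G)
    (hF : ∫⁻ x, ENNReal.ofReal (‖F x‖ ^ p) ∂μ < ∞)
    (hG : ∫⁻ x, ENNReal.ofReal (‖G x‖ ^ p) ∂μ < ∞) :
    ContinuousOn
      (fun t : ℝ => ∫ x, ‖G x + t • (F x - G x)‖ ^ (p - 2) *
        ⟪G x + t • (F x - G x), F x - G x⟫ ∂μ)
      (Set.Icc (0 : ℝ) 1) := by
  refine continuousOn_of_dominated (bound := fun x => 2 * (‖F x‖ ^ p + ‖G x‖ ^ p)) ?_ ?_ ?_ ?_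
  · intro t _
    have hw : StronglyMeasurable fun x => G x + t • (F x - G x) :=
      hGmeas.add ((hFmeas.sub hGmeas).const_smul t)
    exact (hw.norm.measurable.pow_const _).aestronglyMeasurable.mul
      (hw.inner (hFmeas.sub hGmeas)).aestronglyMeasurable
  · exact fun t ht => .of_forall fun x => norm_rpow_mul_inner_segment_le hp (F x) (G x) ht
  · exact ((integrable_norm_rpow_of_lintegral_lt_top hFmeas hF).add
      (integrable_norm_rpow_of_lintegral_lt_top hGmeas hG)).const_mul 2
  · refine .of_forall fun x => Continuous.continuousOn ?_
    have hw : Continuous fun t : ℝ => G x + t • (F x - G x) := by fun_prop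
    exact (hw.norm.rpow_const fun _ => .inr (by linarith)).mul (hw.inner continuous_const)
end

section
/- Let H be a real inner product space and p ≥ 2 a real number. For all a, b ∈ H and every t ∈ [−1, 1] one has ‖(1+t)a + b‖^{p−2} ⟨(1+t)a + b, (1−t)a⟩ − ‖b‖^{p−2} ⟨b, (1−t)a⟩ ≥ 0 (with the convention that a term ‖x‖^{p−2}⟨x, ·⟩ is 0 when x = 0). -/
open scoped RealInnerProductSpace

/-- The map `x ↦ ‖x‖ ^ r • x`, with `r ≥ 0`, is monotone on a real inner product space. -/
theorem inner_norm_rpow_sub_nonneg {H : Type*} [NormedAddCommGroup H] [InnerProductSpace ℝ H]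
    {r : ℝ} (hr : 0 ≤ r) (x y : H) :
    0 ≤ ‖x‖ ^ r * ⟪x, x - y⟫ - ‖y‖ ^ r * ⟪y, x - y⟫ := by
  have hx : 0 ≤ ‖x‖ ^ r := by positivity
  have hy : 0 ≤ ‖y‖ ^ r := by positivity
  have hmono : 0 ≤ (‖x‖ ^ r - ‖y‖ ^ r) * (‖x‖ ^ 2 - ‖y‖ ^ 2) := by
    rcases le_total ‖x‖ ‖y‖ with h | h
    · exact mul_nonneg_of_nonpos_of_nonpos
        (sub_nonpos.2 (Real.rpow_le_rpow (norm_nonneg x) h hr)) (sub_nonpos.2 (by gcongr))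
    · exact mul_nonneg (sub_nonneg.2 (Real.rpow_le_rpow (norm_nonneg y) h hr))
        (sub_nonneg.2 (by gcongr))
  have hsq : 0 ≤ (‖x‖ ^ r + ‖y‖ ^ r) * ‖x - y‖ ^ 2 := by positivity
  rw [norm_sub_sq_real] at hsq
  rw [inner_sub_right, inner_sub_right, real_inner_self_eq_norm_sq, real_inner_self_eq_norm_sq,
    real_inner_comm x y]
  linarith

/-- The pointwise inequality (3.7) from the proof of Theorem 3.6(c): for `a b` in a real inner
product space, `p ≥ 2` and `t ∈ [-1, 1]`,
`‖(1+t)a + b‖^(p-2) ⟨(1+t)a + b, (1-t)a⟩ - ‖b‖^(p-2) ⟨b, (1-t)a⟩ ≥ 0`;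
the term `‖x‖^(p-2)⟨x, ·⟩` vanishes automatically when `x = 0`. -/
theorem stmt5 {H : Type*} [NormedAddCommGroup H] [InnerProductSpace ℝ H]
    (p : ℝ) (hp : 2 ≤ p) (a b : H) (t : ℝ) (ht : t ∈ Set.Icc (-1 : ℝ) 1) :
    ‖(1 + t) • a + b‖ ^ (p - 2) * ⟪(1 + t) • a + b, (1 - t) • a⟫ -
      ‖b‖ ^ (p - 2) * ⟪b, (1 - t) • a⟫ ≥ 0 := by
  obtain ⟨ht₁, ht₂⟩ := ht
  rcases ht₁.eq_or_lt with rfl | ht₁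
  · simp
  have hpos : 0 < 1 + t := by linarith
  have key := inner_norm_rpow_sub_nonneg (sub_nonneg.2 hp) ((1 + t) • a + b) b
  rw [add_sub_cancel_right, real_inner_smul_right, real_inner_smul_right] at key
  rw [real_inner_smul_right, real_inner_smul_right, ge_iff_le]
  have hinner : 0 ≤ ‖(1 + t) • a + b‖ ^ (p - 2) * ⟪(1 + t) • a + b, a⟫ -
      ‖b‖ ^ (p - 2) * ⟪b, a⟫ :=
    nonneg_of_mul_nonneg_right (by linarith) hpos
  linarith [mul_nonneg (sub_nonneg.2 ht₂) hinner]
end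

section
/- Let p ≥ 2 be a real number, u, v : ℝⁿ → ℝ continuously differentiable with compact support, and T : ℝ → ℝ continuously differentiable with T(0) = 0 and |T′(s)| ≤ 1 for all s ∈ ℝ. Then ∫_{ℝⁿ} [ ‖∇(u + T∘u + v)‖^{p−2} ⟨∇(u + T∘u + v), ∇u − ∇(T∘u)⟩ − ‖∇v‖^{p−2} ⟨∇v, ∇u − ∇(T∘u)⟩ ] dx ≥ 0, i.e. the normal contraction T operates on the p-Laplace type operator. -/
open scoped RealInnerProductSpace
open MeasureTheory

/-- Monotonicity of the vector field `x ↦ ‖x‖ ^ q • x` for `0 ≤ q`. -/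
theorem inner_norm_rpow_smul_sub_nonneg {E : Type*} [NormedAddCommGroup E]
    [InnerProductSpace ℝ E] {q : ℝ} (hq : 0 ≤ q) (x y : E) :
    0 ≤ ‖x‖ ^ q * ⟪x, x - y⟫ - ‖y‖ ^ q * ⟪y, x - y⟫ := by
  have hA : 0 ≤ ‖x‖ ^ q := by positivity
  have hB : 0 ≤ ‖y‖ ^ q := by positivity
  have hxy : ⟪x, y⟫ ≤ ‖x‖ * ‖y‖ := real_inner_le_norm x y
  have hx : 0 ≤ ‖x‖ := norm_nonneg x
  have hy : 0 ≤ ‖y‖ := norm_nonneg y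
  have key : 0 ≤ (‖x‖ ^ q * ‖x‖ - ‖y‖ ^ q * ‖y‖) * (‖x‖ - ‖y‖) := by
    rcases le_total ‖x‖ ‖y‖ with h | h
    · have : ‖x‖ ^ q * ‖x‖ ≤ ‖y‖ ^ q * ‖y‖ := by gcongr
      exact mul_nonneg_of_nonpos_of_nonpos (by linarith) (by linarith)
    · have : ‖y‖ ^ q * ‖y‖ ≤ ‖x‖ ^ q * ‖x‖ := by gcongr
      exact mul_nonneg (by linarith) (by linarith)
  rw [inner_sub_right, inner_sub_right, real_inner_self_eq_norm_sq,
    real_inner_self_eq_norm_sq, real_inner_comm x y]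
  nlinarith [mul_le_mul_of_nonneg_left hxy (add_nonneg hA hB)]

theorem hasGradientAt_comp {E : Type*} [NormedAddCommGroup E] [InnerProductSpace ℝ E]
    [CompleteSpace E] {T : ℝ → ℝ} {u : E → ℝ} {x g : E} {t : ℝ}
    (hT : HasDerivAt T t (u x)) (hu : HasGradientAt u g x) :
    HasGradientAt (fun y => T (u y)) (t • g) x := by
  rw [hasGradientAt_iff_hasFDerivAt] at hu ⊢
  simpa [Function.comp_def] using hT.comp_hasFDerivAt x hu

theorem HasGradientAt.add_fun {E : Type*} [NormedAddCommGroup E] [InnerProductSpace ℝ E]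
    [CompleteSpace E] {u w : E → ℝ} {x g h : E}
    (hu : HasGradientAt u g x) (hw : HasGradientAt w h x) :
    HasGradientAt (fun y => u y + w y) (g + h) x := by
  rw [hasGradientAt_iff_hasFDerivAt] at hu hw ⊢
  simpa using hu.fun_add hw

/-- Theorem 3.6(c) for the p-form generated by the classical Dirichlet form: every `C¹` normal
contraction `T` (i.e. `T 0 = 0`, `|T'| ≤ 1`) operates on the p-Laplace type operator:
`⟨L_p(u + T∘u + v) - L_p v, u - T∘u⟩ ≥ 0` for `C¹` compactly supported `u, v`. -/
theorem stmt6 {n : ℕ} (p : ℝ) (hp : 2 ≤ p)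
    (u v : EuclideanSpace ℝ (Fin n) → ℝ)
    (hu : ContDiff ℝ 1 u) (hv : ContDiff ℝ 1 v)
    (husupp : HasCompactSupport u) (hvsupp : HasCompactSupport v)
    (T : ℝ → ℝ) (hT : ContDiff ℝ 1 T) (hT0 : T 0 = 0)
    (hT' : ∀ s : ℝ, |deriv T s| ≤ 1) :
    0 ≤ ∫ x,
      (‖gradient (fun y => u y + T (u y) + v y) x‖ ^ (p - 2) *
          ⟪gradient (fun y => u y + T (u y) + v y) x,
            gradient u x - gradient (fun y => T (u y)) x⟫ -
        ‖gradient v x‖ ^ (p - 2) *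
          ⟪gradient v x, gradient u x - gradient (fun y => T (u y)) x⟫) := by
  refine integral_nonneg fun x => ?_
  have hgu := (hu.differentiable one_ne_zero x).hasGradientAt
  have hgv := (hv.differentiable one_ne_zero x).hasGradientAt
  have hgT := hasGradientAt_comp (hT.differentiable one_ne_zero (u x)).hasDerivAt hgu
  simp only [Pi.zero_apply]
  rw [((hgu.add_fun hgT).add_fun hgv).gradient, hgT.gradient]
  generalize gradient u x = a
  generalize gradient v x = b
  obtain ⟨h₁, h₂⟩ := abs_le.mp (hT' (u x))
  generalize deriv T (u x) = t at h₁ h₂ ⊢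
  have hsub : a - t • a = (1 - t) • a := by module
  have hadd : a + t • a + b = (1 + t) • a + b := by module
  rw [hsub, hadd, inner_smul_right, inner_smul_right]
  rcases h₁.eq_or_lt with rfl | h₁
  · simp
  · have h := inner_norm_rpow_smul_sub_nonneg (sub_nonneg.mpr hp) ((1 + t) • a + b) b
    rw [add_sub_cancel_right, inner_smul_right, inner_smul_right] at h
    have hpos : 0 < 1 + t := by linarith
    have h' : 0 ≤ ‖(1 + t) • a + b‖ ^ (p - 2) * ⟪(1 + t) • a + b, a⟫ -
        ‖b‖ ^ (p - 2) * ⟪b, a⟫ :=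
      nonneg_of_mul_nonneg_right (by linarith) hpos
    linarith [mul_nonneg (sub_nonneg.mpr h₂) h']
end

section
/- Let p ≥ 2 be a real number and u, v : ℝⁿ → ℝ Lipschitz functions with compact support. Set T₁u := min(max(u, 0), 1). Then ∫_{ℝⁿ} [ ‖∇(v + T₁u)‖^{p−2} ⟨∇(v + T₁u), ∇u − ∇(T₁u)⟩ − ‖∇v‖^{p−2} ⟨∇v, ∇u − ∇(T₁u)⟩ ] dx = 0, where the gradients are the almost-everywhere defined gradients of Lipschitz functions; i.e. the unit contraction T₁ C-operates on the p-Laplace type operator. -/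
open scoped RealInnerProductSpace
open MeasureTheory

open Filter Topology in
/-- Where `u` takes values in `(0, 1)` its unit contraction has the same gradient; elsewhere the
unit contraction is extremal, so its gradient vanishes. -/
theorem gradient_unitContraction_eq_or_eq_zero {F : Type*} [NormedAddCommGroup F]
    [InnerProductSpace ℝ F] [CompleteSpace F] {u : F → ℝ} {x : F} (hu : ContinuousAt u x) :
    gradient u x = gradient (fun y => min (max (u y) 0) 1) x ∨
      gradient (fun y => min (max (u y) 0) 1) x = 0 := by
  have lower (y : F) : 0 ≤ min (max (u y) 0) 1 := le_min (le_max_right _ _) zero_le_one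
  have upper (y : F) : min (max (u y) 0) 1 ≤ 1 := min_le_right _ _
  rcases le_or_gt (u x) 0 with h0 | h0
  · right
    have hmin : IsLocalMin (fun y => min (max (u y) 0) 1) x :=
      Eventually.of_forall fun y => by
        simpa only [max_eq_right h0, min_eq_left (zero_le_one' ℝ)] using lower y
    simp [gradient, hmin.fderiv_eq_zero]
  rcases le_or_gt 1 (u x) with h1 | h1
  · right
    have hmax : IsLocalMax (fun y => min (max (u y) 0) 1) x :=
      Eventually.of_forall fun y => by
        simpa only [max_eq_left h0.le, min_eq_right h1] using upper y
    simp [gradient, hmax.fderiv_eq_zero]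
  · left
    have heq : u =ᶠ[𝓝 x] fun y => min (max (u y) 0) 1 := by
      filter_upwards [hu.eventually (Ioo_mem_nhds h0 h1)] with y hy
      rw [max_eq_left hy.1.le, min_eq_left hy.2.le]
    simp only [gradient, heq.fderiv_eq]

/-- Theorem 3.6(a) for the p-form generated by the classical Dirichlet form: the unit
contraction `T₁ u = (u ∨ 0) ∧ 1` C-operates on the p-Laplace type operator:
`⟨L_p(v + T₁u) - L_p v, u - T₁u⟩ = 0` for Lipschitz compactly supported `u, v`,
where the gradients are the a.e.-defined gradients of Lipschitz functions
(Rademacher's theorem). -/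
theorem stmt7 {n : ℕ} (p : ℝ) (hp : 2 ≤ p)
    (u v : EuclideanSpace ℝ (Fin n) → ℝ)
    (Ku Kv : NNReal) (hu : LipschitzWith Ku u) (hv : LipschitzWith Kv v)
    (husupp : HasCompactSupport u) (hvsupp : HasCompactSupport v) :
    ∫ x,
      (‖gradient (fun y => v y + min (max (u y) 0) 1) x‖ ^ (p - 2) *
          ⟪gradient (fun y => v y + min (max (u y) 0) 1) x,
            gradient u x - gradient (fun y => min (max (u y) 0) 1) x⟫ -
        ‖gradient v x‖ ^ (p - 2) *
          ⟪gradient v x,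
            gradient u x - gradient (fun y => min (max (u y) 0) 1) x⟫) = 0 := by
  have hT : LipschitzWith Ku fun y => min (max (u y) 0) 1 := (hu.max_const 0).min_const 1
  refine integral_eq_zero_of_ae ?_
  filter_upwards [hT.ae_differentiableAt, hv.ae_differentiableAt] with x hTx hvx
  have hadd : gradient (fun y => v y + min (max (u y) 0) 1) x =
      gradient v x + gradient (fun y => min (max (u y) 0) 1) x := by
    simp only [gradient, fderiv_fun_add hvx hTx, map_add]
  rcases gradient_unitContraction_eq_or_eq_zero (hu.continuous.continuousAt (x := x)) with h | h
  · simp [← h]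
  · simp [hadd, h]
end

section
/- Let u, v : ℝⁿ → ℝ be Lipschitz functions and p > 0 a real number. Then for almost every x ∈ ℝⁿ the functions u, v, min(u, v) and max(u, v) are all differentiable at x and ‖∇(min(u,v))(x)‖^p + ‖∇(max(u,v))(x)‖^p = ‖∇u(x)‖^p + ‖∇v(x)‖^p. -/
open MeasureTheory

/-- Two functions which touch at a point without crossing have the same derivative there. -/
theorem fderiv_eq_of_le_of_eq {E : Type*} [NormedAddCommGroup E] [NormedSpace ℝ E]
    {f g : E → ℝ} {x : E} (hle : ∀ y, f y ≤ g y) (heq : f x = g x)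
    (hf : DifferentiableAt ℝ f x) (hg : DifferentiableAt ℝ g x) :
    fderiv ℝ f x = fderiv ℝ g x := by
  have hmin : IsLocalMin (g - f) x := Filter.Eventually.of_forall fun y => by
    simpa [heq] using hle y
  have h := hmin.fderiv_eq_zero
  rw [fderiv_sub hg hf, sub_eq_zero] at h
  exact h.symm

open Filter Topology in
/-- Where `u`, `v`, `min u v` and `max u v` are differentiable, the gradients of `min u v` and
`max u v` are those of `u` and `v`, in some order. -/
theorem gradient_min_max_eq_or {E : Type*} [NormedAddCommGroup E] [InnerProductSpace ℝ E]
    [CompleteSpace E] {u v : E → ℝ} {x : E}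
    (hu : DifferentiableAt ℝ u x) (hv : DifferentiableAt ℝ v x)
    (hmin : DifferentiableAt ℝ (fun y => min (u y) (v y)) x)
    (hmax : DifferentiableAt ℝ (fun y => max (u y) (v y)) x) :
    (gradient (fun y => min (u y) (v y)) x = gradient u x ∧
        gradient (fun y => max (u y) (v y)) x = gradient v x) ∨
      (gradient (fun y => min (u y) (v y)) x = gradient v x ∧
        gradient (fun y => max (u y) (v y)) x = gradient u x) := by
  unfold gradient
  rcases lt_trichotomy (u x) (v x) with h | h | h
  · have hlt : ∀ᶠ y in 𝓝 x, u y < v y :=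
      hu.continuousAt.eventually_lt hv.continuousAt h
    left
    constructor <;> congr 1 <;> apply EventuallyEq.fderiv_eq <;>
      filter_upwards [hlt] with y hy
    · exact min_eq_left hy.le
    · exact max_eq_right hy.le
  · left
    constructor <;> congr 1
    · exact fderiv_eq_of_le_of_eq (fun y => min_le_left _ _) (min_eq_left h.le) hmin hu
    · exact (fderiv_eq_of_le_of_eq (fun y => le_max_right _ _) (max_eq_right h.le).symm
        hv hmax).symm
  · have hlt : ∀ᶠ y in 𝓝 x, v y < u y :=
      hv.continuousAt.eventually_lt hu.continuousAt h
    right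
    constructor <;> congr 1 <;> apply EventuallyEq.fderiv_eq <;>
      filter_upwards [hlt] with y hy
    · exact min_eq_right hy.le
    · exact max_eq_left hy.le

/-- The identity (6.4) in gradient form: for Lipschitz `u v : ℝⁿ → ℝ` and `p > 0`, at almost
every point `x` the functions `u`, `v`, `min u v`, `max u v` are differentiable and
`‖∇(u∧v)(x)‖^p + ‖∇(u∨v)(x)‖^p = ‖∇u(x)‖^p + ‖∇v(x)‖^p`. -/
theorem stmt8 {n : ℕ} (p : ℝ) (hp : 0 < p)
    (u v : EuclideanSpace ℝ (Fin n) → ℝ)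
    (Ku Kv : NNReal) (hu : LipschitzWith Ku u) (hv : LipschitzWith Kv v) :
    ∀ᵐ x : EuclideanSpace ℝ (Fin n) ∂volume,
      DifferentiableAt ℝ u x ∧ DifferentiableAt ℝ v x ∧
      DifferentiableAt ℝ (fun y => min (u y) (v y)) x ∧
      DifferentiableAt ℝ (fun y => max (u y) (v y)) x ∧
      ‖gradient (fun y => min (u y) (v y)) x‖ ^ p +
        ‖gradient (fun y => max (u y) (v y)) x‖ ^ p =
      ‖gradient u x‖ ^ p + ‖gradient v x‖ ^ p := by
  filter_upwards [hu.ae_differentiableAt, hv.ae_differentiableAt,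
    (hu.min hv).ae_differentiableAt, (hu.max hv).ae_differentiableAt] with x h1 h2 h3 h4
  refine ⟨h1, h2, h3, h4, ?_⟩
  rcases gradient_min_max_eq_or h1 h2 h3 h4 with ⟨h5, h6⟩ | ⟨h5, h6⟩
  · rw [h5, h6]
  · rw [h5, h6, add_comm]
end

section
/- Let p ≥ 1 be a real number and K ⊆ ℝⁿ compact. Then cap_p(K) = inf { sup { cap_p(L) : L ⊆ U compact } : U open, K ⊆ U }; that is, the value of the Lipschitz p-capacity of a compact set computed directly coincides with its value computed by outer regularization over open neighbourhoods. -/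
open MeasureTheory
open scoped ENNReal

/-- The class `W(K)` of Lipschitz functions with compact support that are `≥ 1` on `K`. -/
def lipTestClass {n : ℕ} (K : Set (EuclideanSpace ℝ (Fin n))) :
    Set (EuclideanSpace ℝ (Fin n) → ℝ) :=
  {u | (∃ L : NNReal, LipschitzWith L u) ∧ HasCompactSupport u ∧ ∀ x ∈ K, 1 ≤ u x}

/-- The Lipschitz `p`-capacity: `cap_p(K) = inf { ∫ ‖∇u‖^p : u ∈ W(K) }` (`inf ∅ = ∞`),
where `∇u` is the a.e.-defined gradient of the Lipschitz function `u`. -/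
noncomputable def lipCap {n : ℕ} (p : ℝ) (K : Set (EuclideanSpace ℝ (Fin n))) : ℝ≥0∞ :=
  ⨅ u ∈ lipTestClass K, ∫⁻ x, ENNReal.ofReal (‖gradient u x‖ ^ p)

/-- Scaling a function by `c ≥ 0` scales its `p`-energy by `c ^ p`. -/
theorem lintegral_norm_gradient_const_mul {n : ℕ} (p : ℝ) {c : ℝ} (hc : 0 ≤ c)
    (u : EuclideanSpace ℝ (Fin n) → ℝ) :
    ∫⁻ x, ENNReal.ofReal (‖gradient (fun y => c * u y) x‖ ^ p) =
      ENNReal.ofReal (c ^ p) * ∫⁻ x, ENNReal.ofReal (‖gradient u x‖ ^ p) := by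
  rw [← lintegral_const_mul' _ _ ENNReal.ofReal_ne_top]
  refine lintegral_congr fun x => ?_
  have hgrad : ‖gradient (fun y => c * u y) x‖ = c * ‖gradient u x‖ := by
    have hfderiv : fderiv ℝ (fun y => c * u y) x = c • fderiv ℝ u x :=
      congrFun (fderiv_const_smul_field (f := u) c) x
    simp only [gradient, LinearIsometryEquiv.norm_map, hfderiv, norm_smul, Real.norm_eq_abs,
      abs_of_nonneg hc]
  rw [hgrad, Real.mul_rpow hc (norm_nonneg _), ENNReal.ofReal_mul (Real.rpow_nonneg hc p)]

/-- If `u` is Lipschitz with compact support, then `c * u` is admissible for every set on which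
it is at least `1`. -/
theorem const_mul_mem_lipTestClass {n : ℕ} {K L : Set (EuclideanSpace ℝ (Fin n))}
    {u : EuclideanSpace ℝ (Fin n) → ℝ} (hu : u ∈ lipTestClass K) (c : ℝ)
    (hL : ∀ x ∈ L, 1 ≤ c * u x) : (fun x => c * u x) ∈ lipTestClass L := by
  obtain ⟨⟨M, hM⟩, hsupp, -⟩ := hu
  exact ⟨⟨‖c‖₊ * M, (lipschitzWith_smul c).comp hM⟩, hsupp.mul_left, hL⟩

/-- Proposition 3.10(1): for a compact set `K`, the Lipschitz `p`-capacity of `K` computed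
directly coincides with its outer regularization over open neighbourhoods:
`cap_p(K) = inf { sup { cap_p(L) : L ⊆ U compact } : U open, K ⊆ U }`. -/
theorem stmt10 {n : ℕ} (p : ℝ) (hp : 1 ≤ p)
    (K : Set (EuclideanSpace ℝ (Fin n))) (hK : IsCompact K) :
    lipCap p K =
      ⨅ (U : Set (EuclideanSpace ℝ (Fin n))) (_ : IsOpen U) (_ : K ⊆ U),
        ⨆ (L : Set (EuclideanSpace ℝ (Fin n))) (_ : IsCompact L) (_ : L ⊆ U),
          lipCap p L := by
  apply le_antisymm
  · exact le_iInf₂ fun U _ => le_iInf fun hKU =>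
      le_iSup₂_of_le K hK (le_iSup_of_le hKU le_rfl)
  · refine le_iInf₂ fun u hu => ?_
    have hlim : Filter.Tendsto
        (fun c : ℝ => ENNReal.ofReal (c ^ p) * ∫⁻ x, ENNReal.ofReal (‖gradient u x‖ ^ p))
        (nhdsWithin 1 (Set.Ioi 1)) (nhds (∫⁻ x, ENNReal.ofReal (‖gradient u x‖ ^ p))) := by
      have hpow : Filter.Tendsto (fun c : ℝ => ENNReal.ofReal (c ^ p))
          (nhdsWithin 1 (Set.Ioi 1)) (nhds 1) := by
        have hcont : ContinuousAt (fun c : ℝ => ENNReal.ofReal (c ^ p)) 1 :=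
          ENNReal.continuous_ofReal.continuousAt.comp
            (Real.continuousAt_rpow_const 1 p (Or.inl one_ne_zero))
        simpa using hcont.tendsto.mono_left nhdsWithin_le_nhds
      simpa using ENNReal.Tendsto.mul_const hpow (Or.inl one_ne_zero)
    refine ge_of_tendsto hlim ?_
    filter_upwards [self_mem_nhdsWithin] with c (hc : 1 < c)
    obtain ⟨M, hM⟩ := hu.1
    have hopen : IsOpen {x | 1 < c * u x} :=
      isOpen_lt continuous_const (continuous_const.mul hM.continuous)
    have hKU : K ⊆ {x | 1 < c * u x} := fun x hx => by
      have hux := hu.2.2 x hx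
      change 1 < c * u x
      nlinarith
    refine iInf₂_le_of_le _ hopen (iInf_le_of_le hKU (iSup₂_le fun L _ => iSup_le fun hLU => ?_))
    rw [← lintegral_norm_gradient_const_mul p (by linarith) u]
    exact iInf₂_le _ (const_mul_mem_lipTestClass hu c fun x hx => (hLU hx).le)
end

section
/- Let p ≥ 1 be a real number and (K_i)_{i∈ℕ} a decreasing sequence of compact subsets of ℝⁿ with K = ⋂_i K_i. Then cap_p(K) = inf_i cap_p(K_i) = lim_i cap_p(K_i) for the Lipschitz p-capacity. -/
open MeasureTheory Filter
open scoped ENNReal Topology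

theorem lipCap_mono {n : ℕ} (p : ℝ) {K L : Set (EuclideanSpace ℝ (Fin n))} (h : K ⊆ L) :
    lipCap p K ≤ lipCap p L :=
  biInf_mono fun _ ⟨hlip, hsupp, hu⟩ => ⟨hlip, hsupp, fun x hx => hu x (h hx)⟩

theorem norm_gradient_const_smul {n : ℕ} (t : ℝ) (u : EuclideanSpace ℝ (Fin n) → ℝ)
    (x : EuclideanSpace ℝ (Fin n)) : ‖gradient (t • u) x‖ = ‖t‖ * ‖gradient u x‖ := by
  simp only [gradient, LinearIsometryEquiv.norm_map, fderiv_const_smul_field, Pi.smul_apply,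
    norm_smul]

theorem lintegral_norm_gradient_const_smul {n : ℕ} (p : ℝ) {t : ℝ} (ht : 0 ≤ t)
    (u : EuclideanSpace ℝ (Fin n) → ℝ) :
    ∫⁻ x, ENNReal.ofReal (‖gradient (t • u) x‖ ^ p) =
      ENNReal.ofReal (t ^ p) * ∫⁻ x, ENNReal.ofReal (‖gradient u x‖ ^ p) := by
  rw [← lintegral_const_mul' _ _ ENNReal.ofReal_ne_top]
  congr 1 with x
  rw [norm_gradient_const_smul, Real.norm_of_nonneg ht, Real.mul_rpow ht (norm_nonneg _),
    ENNReal.ofReal_mul (Real.rpow_nonneg ht p)]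

/-- If `u` is admissible for the intersection, then `t • u` with `t > 1` is admissible for
some member of the decreasing family. -/
theorem exists_const_smul_mem_lipTestClass {n : ℕ} {K : ℕ → Set (EuclideanSpace ℝ (Fin n))}
    (hK : ∀ i, IsCompact (K i)) (hanti : Antitone K) {u : EuclideanSpace ℝ (Fin n) → ℝ}
    (hu : u ∈ lipTestClass (⋂ i, K i)) {t : ℝ} (ht : 1 < t) :
    ∃ i, t • u ∈ lipTestClass (K i) := by
  obtain ⟨⟨L, hL⟩, hsupp, hu⟩ := hu
  have hopen : IsOpen {x | 1 < t * u x} :=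
    isOpen_lt continuous_const (continuous_const.mul hL.continuous)
  obtain ⟨i, hi⟩ := exists_subset_nhds_of_isCompact' hanti.directed_ge hK
    (fun i => (hK i).isClosed) (U := {x | 1 < t * u x}) fun x hx =>
      hopen.mem_nhds (show 1 < t * u x by nlinarith [hu x hx])
  exact ⟨i, ⟨_, (lipschitzWith_smul t).comp hL⟩,
    hsupp.comp_left (g := fun y => t • y) (smul_zero t), fun x hx => (hi hx).le⟩

theorem iInf_lipCap_le {n : ℕ} (p : ℝ) {K : ℕ → Set (EuclideanSpace ℝ (Fin n))}
    (hK : ∀ i, IsCompact (K i)) (hanti : Antitone K) :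
    ⨅ i, lipCap p (K i) ≤ lipCap p (⋂ i, K i) := by
  refine le_iInf₂ fun u hu => ?_
  have hlim : Tendsto (fun t : ℝ => ENNReal.ofReal (t ^ p) *
      ∫⁻ x, ENNReal.ofReal (‖gradient u x‖ ^ p)) (𝓝[>] 1)
      (𝓝 (1 * ∫⁻ x, ENNReal.ofReal (‖gradient u x‖ ^ p))) := by
    refine ENNReal.Tendsto.mul_const ?_ (Or.inl one_ne_zero)
    have h : Tendsto (fun t : ℝ => ENNReal.ofReal (t ^ p)) (𝓝 1) (𝓝 (ENNReal.ofReal (1 ^ p))) :=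
      ENNReal.tendsto_ofReal (Real.continuousAt_rpow_const 1 p (Or.inl one_ne_zero)).tendsto
    simpa using h.mono_left nhdsWithin_le_nhds
  rw [one_mul] at hlim
  refine ge_of_tendsto hlim ?_
  filter_upwards [self_mem_nhdsWithin] with t (ht : 1 < t)
  obtain ⟨i, hi⟩ := exists_const_smul_mem_lipTestClass hK hanti hu ht
  rw [← lintegral_norm_gradient_const_smul p (zero_le_one.trans ht.le)]
  exact (iInf_le _ i).trans (iInf₂_le _ hi)

/-- Theorem 3.11(2b): continuity of the Lipschitz `p`-capacity along decreasing sequences of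
compact sets: if `K i` decreases to `K = ⋂ i, K i`, then
`cap_p(K) = inf_i cap_p(K_i) = lim_i cap_p(K_i)`. -/
theorem stmt11 {n : ℕ} (p : ℝ) (hp : 1 ≤ p)
    (K : ℕ → Set (EuclideanSpace ℝ (Fin n))) (hK : ∀ i, IsCompact (K i))
    (hmono : ∀ i, K (i + 1) ⊆ K i) :
    lipCap p (⋂ i, K i) = ⨅ i, lipCap p (K i) ∧
    Tendsto (fun i => lipCap p (K i)) atTop (𝓝 (lipCap p (⋂ i, K i))) := by
  have hanti : Antitone K := antitone_nat_of_succ_le hmono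
  have heq : lipCap p (⋂ i, K i) = ⨅ i, lipCap p (K i) :=
    le_antisymm (le_iInf fun i => lipCap_mono p (Set.iInter_subset K i))
      (iInf_lipCap_le p hK hanti)
  refine ⟨heq, ?_⟩
  rw [heq]
  exact tendsto_atTop_iInf fun i j hij => lipCap_mono p (hanti hij)
end

section
/- Let X be a Hausdorff topological space and c : 𝒫(X) → [0, ∞] a set function that is monotone, strongly subadditive on compact sets, inner regular on open sets by compact sets, and outer regular by open sets. Then for all finite families of sets E₁, …, E_k ⊆ X and F₁, …, F_k with F_i ⊆ E_i for each i, one has c(⋃_{i=1}^k E_i) + Σ_{i=1}^k c(F_i) ≤ c(⋃_{i=1}^k F_i) + Σ_{i=1}^k c(E_i) (arithmetic in [0, ∞]). -/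
open scoped ENNReal

/-- A monotone set function that is strongly subadditive on compact sets and inner regular on open
sets is strongly subadditive on open sets. -/
theorem strongSubadditive_of_isOpen {X : Type*} [TopologicalSpace X] [T2Space X]
    {c : Set X → ℝ≥0∞} (hmono : Monotone c)
    (hsubadd : ∀ K L : Set X, IsCompact K → IsCompact L →
      c (K ∪ L) + c (K ∩ L) ≤ c K + c L)
    (hinner : ∀ U : Set X, IsOpen U →
      c U = ⨆ (K : Set X) (_ : IsCompact K) (_ : K ⊆ U), c K)
    {U V : Set X} (hU : IsOpen U) (hV : IsOpen V) :
    c (U ∪ V) + c (U ∩ V) ≤ c U + c V := by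
  have key : ∀ K L : Set X, IsCompact K → K ⊆ U ∪ V → IsCompact L → L ⊆ U ∩ V →
      c K + c L ≤ c U + c V := by
    intro K L hK hKUV hL hLUV
    obtain ⟨K₁, K₂, hK₁, hK₂, hK₁U, hK₂V, rfl⟩ := hK.binary_compact_cover hU hV hKUV
    rw [Set.subset_inter_iff] at hLUV
    calc c (K₁ ∪ K₂) + c L
        ≤ c ((K₁ ∪ L) ∪ (K₂ ∪ L)) + c ((K₁ ∪ L) ∩ (K₂ ∪ L)) :=
          add_le_add
            (hmono (Set.union_subset_union Set.subset_union_left Set.subset_union_left))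
            (hmono (Set.subset_inter Set.subset_union_right Set.subset_union_right))
      _ ≤ c (K₁ ∪ L) + c (K₂ ∪ L) := hsubadd _ _ (hK₁.union hL) (hK₂.union hL)
      _ ≤ c U + c V :=
          add_le_add (hmono (Set.union_subset hK₁U hLUV.1)) (hmono (Set.union_subset hK₂V hLUV.2))
  rw [hinner _ (hU.union hV), hinner _ (hU.inter hV)]
  simp only [iSup_and']
  refine ENNReal.biSup_add_biSup_le' ⟨∅, isCompact_empty, Set.empty_subset _⟩
    ⟨∅, isCompact_empty, Set.empty_subset _⟩ ?_
  rintro K ⟨hK, hKUV⟩ L ⟨hL, hLUV⟩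
  exact key K L hK hKUV hL hLUV

/-- A monotone, outer regular set function that is strongly subadditive on open sets is strongly
subadditive on all sets. -/
theorem strongSubadditive_of_outerRegular {X : Type*} [TopologicalSpace X]
    {c : Set X → ℝ≥0∞} (hmono : Monotone c)
    (hopen : ∀ U V : Set X, IsOpen U → IsOpen V → c (U ∪ V) + c (U ∩ V) ≤ c U + c V)
    (houter : ∀ E : Set X,
      c E = ⨅ (U : Set X) (_ : IsOpen U) (_ : E ⊆ U), c U)
    (A B : Set X) : c (A ∪ B) + c (A ∩ B) ≤ c A + c B := by
  refine ENNReal.le_of_forall_pos_le_add fun ε hε hfin => ?_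
  have exists_open : ∀ E : Set X, c E ≠ ∞ →
      ∃ U, IsOpen U ∧ E ⊆ U ∧ c U < c E + (ε / 2 : ℝ≥0∞) := by
    intro E hE
    have h : c E < c E + (ε / 2 : ℝ≥0∞) := ENNReal.lt_add_right hE (by simp [hε.ne'])
    conv_lhs at h => rw [houter E]
    simpa only [iInf_lt_iff, exists_prop] using h
  obtain ⟨hA, hB⟩ := ENNReal.add_lt_top.1 hfin
  obtain ⟨U, hU, hAU, hcU⟩ := exists_open A hA.ne
  obtain ⟨V, hV, hBV, hcV⟩ := exists_open B hB.ne
  calc c (A ∪ B) + c (A ∩ B)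
      ≤ c (U ∪ V) + c (U ∩ V) :=
        add_le_add (hmono (Set.union_subset_union hAU hBV)) (hmono (Set.inter_subset_inter hAU hBV))
    _ ≤ c U + c V := hopen U V hU hV
    _ ≤ (c A + (ε / 2 : ℝ≥0∞)) + (c B + (ε / 2 : ℝ≥0∞)) := add_le_add hcU.le hcV.le
    _ = c A + c B + ε := by rw [add_add_add_comm, ENNReal.add_halves]

/-- A monotone strongly subadditive set function satisfies the finite-family form of strong
subadditivity. -/
theorem biUnion_add_sum_le_of_strongSubadditive {X ι : Type*}
    {c : Set X → ℝ≥0∞} (hmono : Monotone c)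
    (hsubadd : ∀ A B : Set X, c (A ∪ B) + c (A ∩ B) ≤ c A + c B)
    (s : Finset ι) {E F : ι → Set X} (hEF : ∀ i, F i ⊆ E i) :
    c (⋃ i ∈ s, E i) + ∑ i ∈ s, c (F i) ≤ c (⋃ i ∈ s, F i) + ∑ i ∈ s, c (E i) := by
  classical
  have union_add_le : ∀ A B D : Set X, B ⊆ A → c (D ∪ A) + c B ≤ c (D ∪ B) + c A := by
    intro A B D hBA
    calc c (D ∪ A) + c B ≤ c ((D ∪ B) ∪ A) + c ((D ∪ B) ∩ A) :=
          add_le_add (hmono (Set.union_subset_union_left _ Set.subset_union_left))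
            (hmono (Set.subset_inter Set.subset_union_right hBA))
      _ ≤ c (D ∪ B) + c A := hsubadd _ _
  induction s using Finset.induction_on with
  | empty => simp
  | insert a s ha ih =>
    rw [Finset.sum_insert ha, Finset.sum_insert ha, Finset.set_biUnion_insert,
      Finset.set_biUnion_insert]
    set A := ⋃ i ∈ s, E i
    set B := ⋃ i ∈ s, F i
    have hBA : B ⊆ A := Set.iUnion₂_mono fun i _ => hEF i
    by_cases hB : c B = ∞
    · have : c (F a ∪ B) = ∞ := top_le_iff.1 (hB ▸ hmono Set.subset_union_right)
      simp [this]
    refine (ENNReal.add_le_add_iff_right hB).1 ?_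
    have hE := union_add_le A B (E a) hBA
    have hF := union_add_le (E a) (F a) B (hEF a)
    rw [Set.union_comm B, Set.union_comm B] at hF
    calc c (E a ∪ A) + (c (F a) + ∑ i ∈ s, c (F i)) + c B
        = (c (E a ∪ A) + c B) + (c (F a) + ∑ i ∈ s, c (F i)) := by ring
      _ ≤ (c (E a ∪ B) + c A) + (c (F a) + ∑ i ∈ s, c (F i)) := by gcongr
      _ = (c (E a ∪ B) + c (F a)) + (c A + ∑ i ∈ s, c (F i)) := by ring
      _ ≤ (c (F a ∪ B) + c (E a)) + (c B + ∑ i ∈ s, c (E i)) := by gcongr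
      _ = c (F a ∪ B) + (c (E a) + ∑ i ∈ s, c (E i)) + c B := by ring

/-- Lemma 3.12 in subtraction-free form: for a monotone set function `c` on a Hausdorff space
that is strongly subadditive on compact sets, inner regular on open sets by compact sets, and
outer regular by open sets, and finite families `F i ⊆ E i` (`i < k`),
`c(⋃ E i) + ∑ c(F i) ≤ c(⋃ F i) + ∑ c(E i)`. -/
theorem stmt12 {X : Type*} [TopologicalSpace X] [T2Space X]
    (c : Set X → ℝ≥0∞)
    (hmono : ∀ E₁ E₂ : Set X, E₁ ⊆ E₂ → c E₁ ≤ c E₂)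
    (hsubadd : ∀ K L : Set X, IsCompact K → IsCompact L →
      c (K ∪ L) + c (K ∩ L) ≤ c K + c L)
    (hinner : ∀ U : Set X, IsOpen U →
      c U = ⨆ (K : Set X) (_ : IsCompact K) (_ : K ⊆ U), c K)
    (houter : ∀ E : Set X,
      c E = ⨅ (U : Set X) (_ : IsOpen U) (_ : E ⊆ U), c U)
    (k : ℕ) (E F : Fin k → Set X) (hEF : ∀ i, F i ⊆ E i) :
    c (⋃ i, E i) + ∑ i, c (F i) ≤ c (⋃ i, F i) + ∑ i, c (E i) := by
  have hmono' : Monotone c := fun E₁ E₂ => hmono E₁ E₂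
  have hopen : ∀ U V : Set X, IsOpen U → IsOpen V → c (U ∪ V) + c (U ∩ V) ≤ c U + c V :=
    fun _ _ => strongSubadditive_of_isOpen hmono' hsubadd hinner
  simpa using biUnion_add_sum_le_of_strongSubadditive hmono'
    (strongSubadditive_of_outerRegular hmono' hopen houter) Finset.univ hEF
end

section
/- Let X be a Hausdorff topological space and c : 𝒫(X) → [0, ∞] a set function that is monotone, strongly subadditive on compact sets, inner regular on open sets by compact sets, and outer regular by open sets. Then for every increasing sequence (E_i)_{i∈ℕ} of subsets of X (E_i ⊆ E_{i+1}) with E = ⋃_i E_i, one has c(E) = sup_i c(E_i) = lim_i c(E_i). -/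
open Filter
open scoped ENNReal Topology

section SetFunction

variable {X : Type*} [TopologicalSpace X] {c : Set X → ℝ≥0∞}

/-- Strong subadditivity passes from compact sets to open sets by inner regularity. -/
theorem strong_subadditive_of_isOpen [T2Space X]
    (hmono : ∀ E₁ E₂ : Set X, E₁ ⊆ E₂ → c E₁ ≤ c E₂)
    (hsubadd : ∀ K L : Set X, IsCompact K → IsCompact L →
      c (K ∪ L) + c (K ∩ L) ≤ c K + c L)
    (hinner : ∀ U : Set X, IsOpen U →
      c U = ⨆ (K : Set X) (_ : IsCompact K) (_ : K ⊆ U), c K)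
    {U V : Set X} (hU : IsOpen U) (hV : IsOpen V) :
    c (U ∪ V) + c (U ∩ V) ≤ c U + c V := by
  have key : ∀ M N : Set X, IsCompact M → M ⊆ U ∪ V → IsCompact N → N ⊆ U ∩ V →
      c M + c N ≤ c U + c V := by
    intro M N hM hMUV hN hNUV
    obtain ⟨K, L, hK, hL, hKU, hLV, rfl⟩ := hM.binary_compact_cover hU hV hMUV
    calc c (K ∪ L) + c N
        ≤ c ((K ∪ N) ∪ (L ∪ N)) + c ((K ∪ N) ∩ (L ∪ N)) := by
          refine add_le_add (hmono _ _ ?_) (hmono _ _ ?_)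
          · exact Set.union_subset_union Set.subset_union_left Set.subset_union_left
          · exact Set.subset_inter Set.subset_union_right Set.subset_union_right
      _ ≤ c (K ∪ N) + c (L ∪ N) := hsubadd _ _ (hK.union hN) (hL.union hN)
      _ ≤ c U + c V := by
          refine add_le_add (hmono _ _ ?_) (hmono _ _ ?_)
          · exact Set.union_subset hKU (hNUV.trans Set.inter_subset_left)
          · exact Set.union_subset hLV (hNUV.trans Set.inter_subset_right)
  have hsup : ∀ W : Set X, IsOpen W → c W = ⨆ K : {K : Set X // IsCompact K ∧ K ⊆ W}, c K := by
    intro W hW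
    rw [hinner W hW]
    simp only [iSup_subtype, iSup_and]
  have hne : ∀ W : Set X, Nonempty {K : Set X // IsCompact K ∧ K ⊆ W} :=
    fun W => ⟨∅, isCompact_empty, Set.empty_subset W⟩
  have := hne (U ∪ V)
  have := hne (U ∩ V)
  rw [hsup _ (hU.union hV), hsup _ (hU.inter hV)]
  exact ENNReal.iSup_add_iSup_le fun M N => key M N M.2.1 M.2.2 N.2.1 N.2.2

/-- An inner regular set function is continuous along increasing sequences of open sets. -/
theorem apply_iUnion_le_iSup_of_isOpen
    (hmono : ∀ E₁ E₂ : Set X, E₁ ⊆ E₂ → c E₁ ≤ c E₂)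
    (hinner : ∀ U : Set X, IsOpen U →
      c U = ⨆ (K : Set X) (_ : IsCompact K) (_ : K ⊆ U), c K)
    {V : ℕ → Set X} (hV : ∀ n, IsOpen (V n)) (hVmono : Monotone V) :
    c (⋃ n, V n) ≤ ⨆ n, c (V n) := by
  rw [hinner _ (isOpen_iUnion hV)]
  refine iSup_le fun K => iSup_le fun hK => iSup_le fun hKV => ?_
  obtain ⟨n, hn⟩ := hK.elim_directed_cover V hV hKV hVmono.directed_le
  exact (hmono _ _ hn).trans (le_iSup (fun n => c (V n)) n)

/-- An outer regular set function is approximated from outside by open sets. -/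
theorem exists_isOpen_superset_le_add
    (houter : ∀ E : Set X,
      c E = ⨅ (U : Set X) (_ : IsOpen U) (_ : E ⊆ U), c U)
    {A : Set X} (hA : c A ≠ ∞) {ε : ℝ≥0∞} (hε : ε ≠ 0) :
    ∃ U, IsOpen U ∧ A ⊆ U ∧ c U ≤ c A + ε := by
  have h := ENNReal.lt_add_right hA hε
  nth_rewrite 1 [houter A] at h
  simp only [iInf_lt_iff] at h
  obtain ⟨U, hU, hAU, hlt⟩ := h
  exact ⟨U, hU, hAU, hlt.le⟩

/-- Errors of open approximations of an increasing sequence add up along finite unions. -/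
theorem apply_accumulate_le_add_sum
    (hmono : ∀ E₁ E₂ : Set X, E₁ ⊆ E₂ → c E₁ ≤ c E₂)
    (hsubadd : ∀ U V : Set X, IsOpen U → IsOpen V →
      c (U ∪ V) + c (U ∩ V) ≤ c U + c V)
    {E U : ℕ → Set X} (hE : Monotone E) (hfin : ∀ n, c (E n) ≠ ∞)
    (hU : ∀ n, IsOpen (U n)) (hEU : ∀ n, E n ⊆ U n) {ε : ℕ → ℝ≥0∞}
    (hc : ∀ n, c (U n) ≤ c (E n) + ε n) (n : ℕ) :
    c (Set.accumulate U n) ≤ c (E n) + ∑ i ∈ Finset.range (n + 1), ε i := by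
  induction n with
  | zero => simpa using hc 0
  | succ n ih =>
    have hopen : IsOpen (Set.accumulate U n) := isOpen_biUnion fun i _ => hU i
    have hsub : E n ⊆ Set.accumulate U n ∩ U (n + 1) :=
      Set.subset_inter ((hEU n).trans Set.subset_accumulate)
        ((hE n.le_succ).trans (hEU (n + 1)))
    rw [Set.accumulate_succ, Finset.sum_range_succ]
    refine (ENNReal.add_le_add_iff_right (hfin n)).1 ?_
    calc c (Set.accumulate U n ∪ U (n + 1)) + c (E n)
        ≤ c (Set.accumulate U n ∪ U (n + 1)) + c (Set.accumulate U n ∩ U (n + 1)) := by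
          gcongr
          exact hmono _ _ hsub
      _ ≤ c (Set.accumulate U n) + c (U (n + 1)) := hsubadd _ _ hopen (hU _)
      _ ≤ (c (E n) + ∑ i ∈ Finset.range (n + 1), ε i) + (c (E (n + 1)) + ε (n + 1)) :=
          add_le_add ih (hc _)
      _ = c (E (n + 1)) + (∑ i ∈ Finset.range (n + 1), ε i + ε (n + 1)) + c (E n) := by ring

end SetFunction

/-- Theorem 3.11(2c): a monotone set function on a Hausdorff space that is strongly subadditive
on compact sets, inner regular on open sets by compact sets, and outer regular by open sets is
continuous along increasing sequences: `c(⋃ E i) = sup_i c(E i) = lim_i c(E i)`. -/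
theorem stmt13 {X : Type*} [TopologicalSpace X] [T2Space X]
    (c : Set X → ℝ≥0∞)
    (hmono : ∀ E₁ E₂ : Set X, E₁ ⊆ E₂ → c E₁ ≤ c E₂)
    (hsubadd : ∀ K L : Set X, IsCompact K → IsCompact L →
      c (K ∪ L) + c (K ∩ L) ≤ c K + c L)
    (hinner : ∀ U : Set X, IsOpen U →
      c U = ⨆ (K : Set X) (_ : IsCompact K) (_ : K ⊆ U), c K)
    (houter : ∀ E : Set X,
      c E = ⨅ (U : Set X) (_ : IsOpen U) (_ : E ⊆ U), c U)
    (E : ℕ → Set X) (hE : ∀ i, E i ⊆ E (i + 1)) :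
    c (⋃ i, E i) = ⨆ i, c (E i) ∧
    Tendsto (fun i => c (E i)) atTop (𝓝 (c (⋃ i, E i))) := by
  have hEmono : Monotone E := monotone_nat_of_le_succ hE
  have hcmono : Monotone fun i => c (E i) := fun i j hij => hmono _ _ (hEmono hij)
  have heq : c (⋃ i, E i) = ⨆ i, c (E i) := by
    refine le_antisymm ?_ (iSup_le fun i => hmono _ _ (Set.subset_iUnion E i))
    refine ENNReal.le_of_forall_pos_le_add fun δ hδ hlt => ?_
    have hfin : ∀ n, c (E n) ≠ ∞ := fun n => ((le_iSup (fun i => c (E i)) n).trans_lt hlt).ne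
    obtain ⟨ε, hε, hsum⟩ :=
      ENNReal.exists_pos_sum_of_countable' (ENNReal.coe_pos.2 hδ).ne' ℕ
    choose U hU hEU hc using fun n => exists_isOpen_superset_le_add houter (hfin n) (hε n).ne'
    have hopen : ∀ n, IsOpen (Set.accumulate U n) := fun n => isOpen_biUnion fun i _ => hU i
    calc c (⋃ i, E i) ≤ c (⋃ n, Set.accumulate U n) :=
          hmono _ _ (Set.iUnion_mono fun n => (hEU n).trans Set.subset_accumulate)
      _ ≤ ⨆ n, c (Set.accumulate U n) :=
          apply_iUnion_le_iSup_of_isOpen hmono hinner hopen Set.monotone_accumulate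
      _ ≤ (⨆ i, c (E i)) + δ := iSup_le fun n =>
          (apply_accumulate_le_add_sum hmono
            (fun _ _ => strong_subadditive_of_isOpen hmono hsubadd hinner)
            hEmono hfin hU hEU hc n).trans
          (add_le_add (le_iSup (fun i => c (E i)) n) ((ENNReal.sum_le_tsum _).trans hsum.le))
  exact ⟨heq, heq ▸ tendsto_atTop_iSup hcmono⟩
end

section
/- Let X be a Hausdorff topological space and c : 𝒫(X) → [0, ∞] a set function that is monotone, strongly subadditive on compact sets, inner regular on open sets by compact sets, and outer regular by open sets. Then c is countably subadditive: for every sequence (E_i)_{i∈ℕ} of subsets of X, c(⋃_{i∈ℕ} E_i) ≤ Σ_{i∈ℕ} c(E_i). -/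
open scoped ENNReal

section Capacity

variable {X : Type*} [TopologicalSpace X] {c : Set X → ℝ≥0∞}

theorem capacity_union_le_of_isOpen [T2Space X]
    (hmono : ∀ E₁ E₂ : Set X, E₁ ⊆ E₂ → c E₁ ≤ c E₂)
    (hsubadd : ∀ K L : Set X, IsCompact K → IsCompact L →
      c (K ∪ L) + c (K ∩ L) ≤ c K + c L)
    (hinner : ∀ U : Set X, IsOpen U →
      c U = ⨆ (K : Set X) (_ : IsCompact K) (_ : K ⊆ U), c K)
    {U V : Set X} (hU : IsOpen U) (hV : IsOpen V) : c (U ∪ V) ≤ c U + c V := by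
  rw [hinner _ (hU.union hV)]
  refine iSup_le fun K => iSup_le fun hK => iSup_le fun hKUV => ?_
  obtain ⟨K₁, K₂, hK₁, hK₂, hK₁U, hK₂V, rfl⟩ := hK.binary_compact_cover hU hV hKUV
  calc c (K₁ ∪ K₂) ≤ c (K₁ ∪ K₂) + c (K₁ ∩ K₂) := le_self_add
    _ ≤ c K₁ + c K₂ := hsubadd _ _ hK₁ hK₂
    _ ≤ c U + c V := add_le_add (hmono _ _ hK₁U) (hmono _ _ hK₂V)

theorem isOpen_partialSups {U : ℕ → Set X} (hU : ∀ i, IsOpen (U i)) (n : ℕ) :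
    IsOpen (partialSups U n) := by
  induction n with
  | zero => simpa using hU 0
  | succ n ih =>
    rw [partialSups_add_one]
    exact ih.union (hU _)

theorem capacity_iUnion_le_of_isOpen [T2Space X]
    (hmono : ∀ E₁ E₂ : Set X, E₁ ⊆ E₂ → c E₁ ≤ c E₂)
    (hsubadd : ∀ K L : Set X, IsCompact K → IsCompact L →
      c (K ∪ L) + c (K ∩ L) ≤ c K + c L)
    (hinner : ∀ U : Set X, IsOpen U →
      c U = ⨆ (K : Set X) (_ : IsCompact K) (_ : K ⊆ U), c K)
    {U : ℕ → Set X} (hU : ∀ i, IsOpen (U i)) : c (⋃ i, U i) ≤ ∑' i, c (U i) := by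
  have hpartial (n : ℕ) : c (partialSups U n) ≤ ∑ i ∈ Finset.range (n + 1), c (U i) := by
    induction n with
    | zero => simp
    | succ n ih =>
      rw [partialSups_add_one, Finset.sum_range_succ]
      exact (capacity_union_le_of_isOpen hmono hsubadd hinner
        (isOpen_partialSups hU n) (hU _)).trans (by gcongr)
  rw [hinner _ (isOpen_iUnion hU)]
  refine iSup_le fun K => iSup_le fun hK => iSup_le fun hKU => ?_
  obtain ⟨n, hn⟩ := hK.elim_directed_cover (fun n => partialSups U n) (isOpen_partialSups hU)
    (hKU.trans (Set.iUnion_mono fun i => le_partialSups U i))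
    (partialSups U).monotone.directed_le
  exact (hmono _ _ hn).trans ((hpartial n).trans (ENNReal.sum_le_tsum _))

theorem exists_isOpen_capacity_le_add
    (houter : ∀ E : Set X,
      c E = ⨅ (U : Set X) (_ : IsOpen U) (_ : E ⊆ U), c U)
    {E : Set X} (hE : c E ≠ ∞) {δ : ℝ≥0∞} (hδ : δ ≠ 0) :
    ∃ U, IsOpen U ∧ E ⊆ U ∧ c U ≤ c E + δ := by
  have hlt : c E < c E + δ := ENNReal.lt_add_right hE hδ
  nth_rewrite 1 [houter E] at hlt
  simp only [iInf_lt_iff] at hlt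
  obtain ⟨U, hU, hEU, h⟩ := hlt
  exact ⟨U, hU, hEU, h.le⟩

end Capacity

/-- Theorem 3.11(3): a monotone set function on a Hausdorff space that is strongly subadditive
on compact sets, inner regular on open sets by compact sets, and outer regular by open sets is
countably subadditive: `c(⋃ E i) ≤ ∑' c(E i)`. -/
theorem stmt14 {X : Type*} [TopologicalSpace X] [T2Space X]
    (c : Set X → ℝ≥0∞)
    (hmono : ∀ E₁ E₂ : Set X, E₁ ⊆ E₂ → c E₁ ≤ c E₂)
    (hsubadd : ∀ K L : Set X, IsCompact K → IsCompact L →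
      c (K ∪ L) + c (K ∩ L) ≤ c K + c L)
    (hinner : ∀ U : Set X, IsOpen U →
      c U = ⨆ (K : Set X) (_ : IsCompact K) (_ : K ⊆ U), c K)
    (houter : ∀ E : Set X,
      c E = ⨅ (U : Set X) (_ : IsOpen U) (_ : E ⊆ U), c U)
    (E : ℕ → Set X) :
    c (⋃ i, E i) ≤ ∑' i, c (E i) := by
  refine ENNReal.le_of_forall_pos_le_add fun ε hε hfin => ?_
  obtain ⟨δ, hδ, hsum⟩ := ENNReal.exists_pos_sum_of_countable' (ENNReal.coe_pos.2 hε).ne' ℕ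
  choose U hU hEU hcU using fun i => exists_isOpen_capacity_le_add houter
    (ENNReal.ne_top_of_tsum_ne_top hfin.ne i) (hδ i).ne'
  calc c (⋃ i, E i) ≤ c (⋃ i, U i) := hmono _ _ (Set.iUnion_mono hEU)
    _ ≤ ∑' i, c (U i) := capacity_iUnion_le_of_isOpen hmono hsubadd hinner hU
    _ ≤ ∑' i, (c (E i) + δ i) := ENNReal.tsum_le_tsum hcU
    _ = ∑' i, c (E i) + ∑' i, δ i := ENNReal.tsum_add
    _ ≤ ∑' i, c (E i) + ε := by gcongr
end

section
/- Let Ω ⊆ ℝⁿ be open, p ≥ 2 a real number, and u : Ω → ℝ a continuously differentiable weakly p-harmonic function, i.e. ∫_Ω ‖∇u‖^{p−2} ⟨∇u, ∇η⟩ dx = 0 for every continuously differentiable η : Ω → ℝ with compact support in Ω. Then for every continuously differentiable φ : Ω → ℝ with φ ≥ 0 and compact support in Ω, and every c ∈ ℝ, one has (∫_Ω φ^p ‖∇u‖^p dx)^{1/p} ≤ p · (∫_Ω ‖∇φ‖^p |u − c|^p dx)^{1/p}. -/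
open scoped RealInnerProductSpace
open MeasureTheory

section Caccioppoli

variable {E : Type*} [NormedAddCommGroup E] [InnerProductSpace ℝ E] [CompleteSpace E]

theorem inner_gradient_right_eq_fderiv (f : E → ℝ) (x v : E) :
    ⟪v, gradient f x⟫ = fderiv ℝ f x v := by
  rw [real_inner_comm, gradient, InnerProductSpace.toDual_symm_apply]

theorem ContDiffOn.continuousOn_gradient {f : E → ℝ} {s : Set E} (hf : ContDiffOn ℝ 1 f s)
    (hs : IsOpen s) : ContinuousOn (gradient f) s :=
  (InnerProductSpace.toDual ℝ E).symm.continuous.comp_continuousOn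
    (hf.continuousOn_fderiv_of_isOpen hs le_rfl)

theorem tsupport_gradient_subset (f : E → ℝ) : tsupport (gradient f) ⊆ tsupport f := by
  refine (closure_mono fun x hx => ?_).trans (tsupport_fderiv_subset (𝕜 := ℝ) (f := f))
  rw [Function.mem_support] at hx ⊢
  contrapose! hx
  simp [gradient, hx]

/-- The gradient of `f ^ p * (u - c)`, paired with a vector. -/
theorem inner_gradient_rpow_mul_sub {f u : E → ℝ} {x : E} {p : ℝ} (hp : 1 ≤ p)
    (hf : DifferentiableAt ℝ f x) (hu : DifferentiableAt ℝ u x) (c : ℝ) (v : E) :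
    ⟪v, gradient (fun y => f y ^ p * (u y - c)) x⟫ =
      f x ^ p * ⟪v, gradient u x⟫ + p * f x ^ (p - 1) * (u x - c) * ⟪v, gradient f x⟫ := by
  have h := (hf.hasFDerivAt.rpow_const (Or.inr hp)).mul (hu.hasFDerivAt.sub_const c)
  have h' : HasFDerivAt (fun y => f y ^ p * (u y - c)) _ x := h
  simp only [inner_gradient_right_eq_fderiv]
  rw [h'.fderiv]
  simp
  ring

end Caccioppoli

/-- Absorbing the left-hand side in an estimate `A ≤ p * (A ^ (1 / q) * B)`. -/
theorem Real.rpow_one_div_le_of_le_mul_rpow {p q A B C : ℝ} (hpq : p.HolderConjugate q)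
    (hA : 0 ≤ A) (hB : 0 ≤ B) (hC : 0 ≤ C) (h : A ≤ C * (A ^ (1 / q) * B)) :
    A ^ (1 / p) ≤ C * B := by
  rcases hA.eq_or_lt with rfl | hA
  · rw [Real.zero_rpow (one_div_ne_zero hpq.ne_zero)]
    positivity
  · have hq : 0 < A ^ (1 / q) := Real.rpow_pos_of_pos hA _
    refine le_of_mul_le_mul_left ?_ hq
    rw [← Real.rpow_add hA, one_div, one_div, add_comm, hpq.inv_add_inv_eq_one, Real.rpow_one]
    rw [one_div] at h
    linarith

/-- Caccioppoli type inequality (Proposition 5.1) for the p-Laplace operator: if `u` is `C¹`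
on the open set `Ω ⊆ ℝⁿ` and weakly p-harmonic, i.e. `∫_Ω ‖∇u‖^(p-2)⟨∇u, ∇η⟩ = 0` for all
`C¹` test functions `η` with compact support in `Ω`, then for every nonnegative `C¹`
function `φ` with compact support in `Ω` and every `c ∈ ℝ`,
`(∫_Ω φ^p ‖∇u‖^p)^(1/p) ≤ p (∫_Ω ‖∇φ‖^p |u - c|^p)^(1/p)`. -/
theorem stmt15 {n : ℕ} (Ω : Set (EuclideanSpace ℝ (Fin n))) (hΩ : IsOpen Ω)
    (p : ℝ) (hp : 2 ≤ p)
    (u : EuclideanSpace ℝ (Fin n) → ℝ) (hu : ContDiffOn ℝ 1 u Ω)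
    (huharm : ∀ η : EuclideanSpace ℝ (Fin n) → ℝ, ContDiff ℝ 1 η → HasCompactSupport η →
      tsupport η ⊆ Ω →
      ∫ x in Ω, ‖gradient u x‖ ^ (p - 2) * ⟪gradient u x, gradient η x⟫ = 0)
    (φ : EuclideanSpace ℝ (Fin n) → ℝ) (hφ : ContDiff ℝ 1 φ) (hφ0 : ∀ x, 0 ≤ φ x)
    (hφsupp : HasCompactSupport φ) (hφΩ : tsupport φ ⊆ Ω) (c : ℝ) :
    (∫ x in Ω, φ x ^ p * ‖gradient u x‖ ^ p) ^ (1 / p) ≤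
      p * (∫ x in Ω, ‖gradient φ x‖ ^ p * |u x - c| ^ p) ^ (1 / p) := by
  have hp0 : 0 < p := by linarith
  have hgu : ContinuousOn (gradient u) Ω := hu.continuousOn_gradient hΩ
  have hgφ : Continuous (gradient φ) :=
    continuousOn_univ.mp ((contDiffOn_univ.mpr hφ).continuousOn_gradient isOpen_univ)
  have hdu : ∀ x ∈ Ω, DifferentiableAt ℝ u x := fun x hx =>
    (hu.differentiableOn one_ne_zero).differentiableAt (hΩ.mem_nhds hx)
  have hdφ : ∀ x, DifferentiableAt ℝ φ x := fun x => hφ.differentiable one_ne_zero x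
  set F : EuclideanSpace ℝ (Fin n) → ℝ := fun x => (φ x * ‖gradient u x‖) ^ (p - 1) with hF
  set G : EuclideanSpace ℝ (Fin n) → ℝ := fun x => ‖gradient φ x‖ * |u x - c| with hG
  set η : EuclideanSpace ℝ (Fin n) → ℝ := fun x => φ x ^ p * (u x - c) with hη
  have tsub : ∀ f : EuclideanSpace ℝ (Fin n) → ℝ, (∀ x, φ x = 0 → f x = 0) →
      tsupport f ⊆ tsupport φ := fun f hf =>
    closure_mono fun x hx => by
      rw [Function.mem_support] at hx ⊢
      exact fun h => hx (hf x h)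
  have hcs : ∀ f : EuclideanSpace ℝ (Fin n) → ℝ, tsupport f ⊆ tsupport φ →
      HasCompactSupport f := fun f hf => hφsupp.isCompact.of_isClosed_subset
        (isClosed_tsupport f) hf
  have hFt : tsupport F ⊆ tsupport φ := tsub F fun x hx => by
    simp only [hF, hx, zero_mul]
    exact Real.zero_rpow (by linarith)
  have hGt : tsupport G ⊆ tsupport φ :=
    (closure_mono fun x hx => by
      rw [Function.mem_support] at hx ⊢
      contrapose! hx
      simp [hG, hx]).trans (tsupport_gradient_subset φ)
  have hηt : tsupport η ⊆ tsupport φ := tsub η fun x hx => by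
    simp only [hη, hx, Real.zero_rpow hp0.ne', zero_mul]
  have hFc : Continuous F := by
    refine ContinuousOn.continuous_of_tsupport_subset (s := Ω) ?_ hΩ (hFt.trans hφΩ)
    exact (hφ.continuous.continuousOn.mul hgu.norm).rpow_const fun x _ => Or.inr (by linarith)
  have hGc : Continuous G := by
    refine ContinuousOn.continuous_of_tsupport_subset (s := Ω) ?_ hΩ (hGt.trans hφΩ)
    exact hgφ.norm.continuousOn.mul (hu.continuousOn.sub continuousOn_const).abs
  have hηc : ContDiff ℝ 1 η := by
    refine contDiff_iff_contDiffAt.mpr fun x => ?_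
    by_cases hx : x ∈ tsupport η
    swap
    · exact contDiffAt_const.congr_of_eventuallyEq (notMem_tsupport_iff_eventuallyEq.mp hx)
    have hx' : Ω ∈ nhds x := hΩ.mem_nhds (hφΩ (hηt hx))
    refine ContDiffAt.mul ?_ ((hu.contDiffAt hx').sub contDiffAt_const)
    exact (hφ.rpow_const_of_le (m := 1) (by norm_num; linarith)).contDiffAt
  have hpq : p.HolderConjugate (p / (p - 1)) := Real.HolderConjugate.conjExponent (by linarith)
  have hF0 : ∀ x, 0 ≤ F x := fun x => by have := hφ0 x; positivity
  have hG0 : ∀ x, 0 ≤ G x := fun x => by positivity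
  have hFq : ∀ x, F x ^ (p / (p - 1)) = φ x ^ p * ‖gradient u x‖ ^ p := fun x => by
    have := hφ0 x
    rw [hF, ← Real.rpow_mul (by positivity), mul_div_cancel₀ _ (by linarith),
      Real.mul_rpow this (norm_nonneg _)]
  have hGp : ∀ x, G x ^ p = ‖gradient φ x‖ ^ p * |u x - c| ^ p := fun x =>
    Real.mul_rpow (norm_nonneg _) (abs_nonneg _)
  have holder := integral_mul_le_Lp_mul_Lq_of_nonneg (μ := volume.restrict Ω) hpq.symm
    (Filter.Eventually.of_forall hF0) (Filter.Eventually.of_forall hG0)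
    ((hFc.memLp_of_hasCompactSupport (hcs F hFt)).restrict Ω)
    ((hGc.memLp_of_hasCompactSupport (hcs G hGt)).restrict Ω)
  simp only [hFq, hGp] at holder
  refine Real.rpow_one_div_le_of_le_mul_rpow hpq
    (integral_nonneg fun x => by have := hφ0 x; positivity)
    (Real.rpow_nonneg (integral_nonneg fun x => by positivity) _) hp0.le ?_
  refine le_trans ?_ (mul_le_mul_of_nonneg_left holder hp0.le)
  have hFGi : Integrable (fun x => F x * G x) (volume.restrict Ω) :=
    ((hFc.mul hGc).integrable_of_hasCompactSupport ((hcs F hFt).mul_right)).restrict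
  have hAi : Integrable (fun x => φ x ^ p * ‖gradient u x‖ ^ p) (volume.restrict Ω) := by
    have hc : Continuous fun x => φ x ^ p * ‖gradient u x‖ ^ p := by
      simp only [← hFq]
      exact hFc.rpow_const fun x => Or.inr hpq.symm.nonneg
    exact (hc.integrable_of_hasCompactSupport (hcs _ (tsub _ fun x hx => by
      simp only [hx, Real.zero_rpow hp0.ne', zero_mul]))).restrict
  have hTi : Integrable (fun x => ‖gradient u x‖ ^ (p - 2) * ⟪gradient u x, gradient η x⟫)
      (volume.restrict Ω) := by
    have ht : tsupport (fun x => ‖gradient u x‖ ^ (p - 2) * ⟪gradient u x, gradient η x⟫) ⊆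
        tsupport φ :=
      (closure_mono fun x hx => by
        rw [Function.mem_support] at hx ⊢
        contrapose! hx
        simp [hx]).trans ((tsupport_gradient_subset η).trans hηt)
    have hgη : Continuous (gradient η) :=
      continuousOn_univ.mp ((contDiffOn_univ.mpr hηc).continuousOn_gradient isOpen_univ)
    have hc := ContinuousOn.continuous_of_tsupport_subset (s := Ω)
      ((hgu.norm.rpow_const fun x _ => Or.inr (by linarith)).mul
        (ContinuousOn.inner (𝕜 := ℝ) hgu hgη.continuousOn)) hΩ (ht.trans hφΩ)
    exact (hc.integrable_of_hasCompactSupport (hcs _ ht)).restrict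
  rw [← sub_zero (∫ x in Ω, φ x ^ p * ‖gradient u x‖ ^ p),
    ← huharm η hηc (hcs η hηt) (hηt.trans hφΩ), ← integral_sub hAi hTi, ← integral_const_mul]
  refine setIntegral_mono_on (hAi.sub hTi) (hFGi.const_mul p) hΩ.measurableSet fun x hx => ?_
  rw [hη, inner_gradient_rpow_mul_sub (by linarith) (hdφ x) (hdu x hx),
    real_inner_self_eq_norm_sq]
  have ha := norm_nonneg (gradient u x)
  have h2 : ‖gradient u x‖ ^ (p - 2) * ‖gradient u x‖ ^ 2 = ‖gradient u x‖ ^ p := by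
    rw [← Real.rpow_natCast, ← Real.rpow_add_of_nonneg ha (by linarith) (by norm_num)]
    norm_num
  have h1 : ‖gradient u x‖ ^ (p - 2) * ‖gradient u x‖ = ‖gradient u x‖ ^ (p - 1) := by
    conv_lhs => rw [← Real.rpow_one ‖gradient u x‖]
    rw [Real.rpow_one, ← Real.rpow_add_one' ha (by linarith)]
    congr 1
    ring
  have hFx : F x = φ x ^ (p - 1) * ‖gradient u x‖ ^ (p - 1) := Real.mul_rpow (hφ0 x) ha
  have hφx : 0 ≤ φ x ^ (p - 1) := Real.rpow_nonneg (hφ0 x) _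
  have hcs' : -((u x - c) * ⟪gradient u x, gradient φ x⟫) ≤
      |u x - c| * (‖gradient u x‖ * ‖gradient φ x‖) := by
    refine (neg_le_abs _).trans ?_
    rw [abs_mul]
    exact mul_le_mul_of_nonneg_left (abs_real_inner_le_norm _ _) (abs_nonneg _)
  calc _ = p * φ x ^ (p - 1) * ‖gradient u x‖ ^ (p - 2) *
        -((u x - c) * ⟪gradient u x, gradient φ x⟫) := by rw [← h2]; ring
    _ ≤ p * φ x ^ (p - 1) * ‖gradient u x‖ ^ (p - 2) *
        (|u x - c| * (‖gradient u x‖ * ‖gradient φ x‖)) :=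
      mul_le_mul_of_nonneg_left hcs' (by positivity)
    _ = p * (F x * G x) := by rw [hFx, ← h1, hG]; ring
end
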